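/- Let (E, V, s, t, r) be a finite rooted oriented loopless multigraph, let G be its reduced Goeritz matrix, assumed to have nonzero determinant, and let v be the signed-degree vector of the orientation. Let q(u) := u·(G⁻¹ u) be the quadratic form over ℚ associated to G. Then for every integer vector y indexed by the non-root vertices V', q(v − 2·(G y)) ≤ q(v); that is, v attains the maximum value of q over its 2·im(G)-orbit {v − 2·(G y) : y an integer vector}. (This is the algebraic content of the paper's Proposition that for a Kauffman state x in a connected alternating diagram, the degrees vector v_x^W attains the maximum value of q in the orbit corresponding to the spin^c structure t(x).) -/

import Mathlib

open Matrix

/-- The reduced Goeritz matrix of a finite rooted oriented loopless multigraph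
`(E, V, s, t, r)`: indexed by the non-root vertices, with off-diagonal entry the
number of edges joining the two vertices, and diagonal entry minus the number of
incident edges. -/
def reducedGoeritz (E V : Type*) [Fintype E] [Fintype V] [DecidableEq V]
    (s t : E → V) (r : V) : Matrix {w : V // w ≠ r} {w : V // w ≠ r} ℤ :=
  Matrix.of fun u w =>
    if (u : V) = (w : V) then
      -((Finset.univ.filter fun e : E => s e = (u : V) ∨ t e = (u : V)).card : ℤ)
    else
      ((Finset.univ.filter fun e : E =>
        ({s e, t e} : Finset V) = {(u : V), (w : V)}).card : ℤ)

/-- The signed-degree vector of the orientation: `v w = #{e : s e = w} − #{e : t e = w}`. -/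
def signedDegree (E V : Type*) [Fintype E] [Fintype V] [DecidableEq V]
    (s t : E → V) (r : V) : {w : V // w ≠ r} → ℤ :=
  fun w => ((Finset.univ.filter fun e : E => s e = (w : V)).card : ℤ)
    - ((Finset.univ.filter fun e : E => t e = (w : V)).card : ℤ)

/-- The signed incidence matrix of an oriented graph, restricted to the non-root vertices. -/
def reducedIncidence (E V : Type*) [DecidableEq V] (s t : E → V) (r : V) :
    Matrix {w : V // w ≠ r} E ℤ :=
  Matrix.of fun w e => (if s e = (w : V) then 1 else 0) - (if t e = (w : V) then 1 else 0)

theorem reducedGoeritz_eq_neg_mul_transpose {E V : Type*} [Fintype E] [Fintype V] [DecidableEq V]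
    (s t : E → V) (r : V) (hst : ∀ e, s e ≠ t e) :
    reducedGoeritz E V s t r =
      -(reducedIncidence E V s t r * (reducedIncidence E V s t r)ᵀ) := by
  ext ⟨u, hu⟩ ⟨w, hw⟩
  simp only [reducedGoeritz, reducedIncidence, Matrix.of_apply, Matrix.neg_apply,
    Matrix.mul_apply, Matrix.transpose_apply]
  split_ifs with h
  · subst h
    rw [Finset.card_filter, Nat.cast_sum]
    congr 1
    refine Finset.sum_congr rfl fun e _ => ?_
    have := hst e
    by_cases h₁ : s e = u <;> by_cases h₂ : t e = u <;> simp_all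
  · rw [Finset.card_filter, Nat.cast_sum, ← Finset.sum_neg_distrib]
    refine Finset.sum_congr rfl fun e _ => ?_
    have hiff : ({s e, t e} : Finset V) = {u, w} ↔
        (s e = u ∧ t e = w) ∨ (s e = w ∧ t e = u) := by
      rw [← Finset.coe_inj]
      push_cast
      exact Set.pair_eq_pair_iff
    have := hst e
    simp only [hiff]
    split_ifs <;> simp_all

theorem signedDegree_eq_mulVec_one {E V : Type*} [Fintype E] [Fintype V] [DecidableEq V]
    (s t : E → V) (r : V) :
    signedDegree E V s t r = reducedIncidence E V s t r *ᵥ 1 := by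
  ext w
  simp [signedDegree, reducedIncidence, Matrix.mulVec, dotProduct, Finset.sum_sub_distrib]

theorem dotProduct_reducedGoeritz_mulVec_le {E V : Type*} [Fintype E] [Fintype V] [DecidableEq V]
    (s t : E → V) (r : V) (hst : ∀ e, s e ≠ t e) (y : {w : V // w ≠ r} → ℤ) :
    y ⬝ᵥ (reducedGoeritz E V s t r *ᵥ y) ≤ signedDegree E V s t r ⬝ᵥ y := by
  rw [reducedGoeritz_eq_neg_mul_transpose s t r hst, signedDegree_eq_mulVec_one,
    Matrix.neg_mulVec, dotProduct_neg, ← Matrix.mulVec_mulVec, Matrix.dotProduct_mulVec,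
    ← Matrix.mulVec_transpose, dotProduct_comm _ y, Matrix.dotProduct_mulVec y,
    ← Matrix.mulVec_transpose]
  set z := (reducedIncidence E V s t r)ᵀ *ᵥ y
  simp only [dotProduct, Pi.one_apply, mul_one, ← Finset.sum_neg_distrib]
  refine Finset.sum_le_sum fun e _ => ?_
  rcases le_or_gt 0 (z e) with h | h <;> nlinarith

theorem dotProduct_inv_mulVec_sub_two_smul {n R : Type*} [Fintype n] [DecidableEq n] [CommRing R]
    {A : Matrix n n R} (hA : A.IsSymm) (hdet : IsUnit A.det) (v x : n → R) :
    (v - (2 : R) • (A *ᵥ x)) ⬝ᵥ (A⁻¹ *ᵥ (v - (2 : R) • (A *ᵥ x))) =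
      v ⬝ᵥ (A⁻¹ *ᵥ v) - 4 * (v ⬝ᵥ x - x ⬝ᵥ (A *ᵥ x)) := by
  have hinv : A⁻¹ *ᵥ (A *ᵥ x) = x := by
    rw [Matrix.mulVec_mulVec, Matrix.nonsing_inv_mul _ hdet, Matrix.one_mulVec]
  have hcross : (A *ᵥ x) ⬝ᵥ (A⁻¹ *ᵥ v) = v ⬝ᵥ x := by
    rw [dotProduct_comm, ← Matrix.vecMul_transpose A, hA.eq, ← dotProduct_comm,
      ← Matrix.dotProduct_mulVec, Matrix.mulVec_mulVec, Matrix.mul_nonsing_inv _ hdet,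
      Matrix.one_mulVec, dotProduct_comm]
  simp only [Matrix.mulVec_sub, Matrix.mulVec_smul, hinv, sub_dotProduct, dotProduct_sub,
    smul_dotProduct, dotProduct_smul, hcross, smul_eq_mul, dotProduct_comm (A *ᵥ x) x]
  ring

/-- For a finite rooted oriented loopless multigraph whose reduced
Goeritz matrix `G` has nonzero determinant, the signed-degree vector `v` attains
the maximum of the quadratic form `q u := u ⬝ (G⁻¹ u)` (over `ℚ`) on its
`2·im(G)`-orbit: `q (v - 2 G y) ≤ q v` for every integer vector `y`. -/
theorem quadForm_reducedGoeritz_max_on_orbit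
    {E V : Type*} [Fintype E] [Fintype V] [DecidableEq V]
    (s t : E → V) (r : V) (hst : ∀ e, s e ≠ t e)
    (hdet : (reducedGoeritz E V s t r).det ≠ 0)
    (y : {w : V // w ≠ r} → ℤ) :
    ((fun w => ((signedDegree E V s t r w : ℤ) : ℚ))
        - (2 : ℚ) • (((reducedGoeritz E V s t r).map ((↑) : ℤ → ℚ)) *ᵥ
            fun w => ((y w : ℤ) : ℚ)))
      ⬝ᵥ ((((reducedGoeritz E V s t r).map ((↑) : ℤ → ℚ))⁻¹) *ᵥ
        ((fun w => ((signedDegree E V s t r w : ℤ) : ℚ))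
          - (2 : ℚ) • (((reducedGoeritz E V s t r).map ((↑) : ℤ → ℚ)) *ᵥ
              fun w => ((y w : ℤ) : ℚ))))
    ≤ (fun w => ((signedDegree E V s t r w : ℤ) : ℚ))
      ⬝ᵥ ((((reducedGoeritz E V s t r).map ((↑) : ℤ → ℚ))⁻¹) *ᵥ
        fun w => ((signedDegree E V s t r w : ℤ) : ℚ)) := by
  have hsymm : (reducedGoeritz E V s t r).IsSymm := by
    simp [Matrix.IsSymm, reducedGoeritz_eq_neg_mul_transpose s t r hst]
  have hunit : IsUnit ((reducedGoeritz E V s t r).map ((↑) : ℤ → ℚ)).det := by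
    rw [isUnit_iff_ne_zero, ← Int.cast_det]
    exact_mod_cast hdet
  rw [dotProduct_inv_mulVec_sub_two_smul (hsymm.map _) hunit]
  have hle : (fun w => (y w : ℚ)) ⬝ᵥ
      ((reducedGoeritz E V s t r).map ((↑) : ℤ → ℚ) *ᵥ fun w => (y w : ℚ)) ≤
      (fun w => (signedDegree E V s t r w : ℚ)) ⬝ᵥ fun w => (y w : ℚ) := by
    have h := dotProduct_reducedGoeritz_mulVec_le s t r hst y
    simp only [dotProduct, Matrix.mulVec, Matrix.map_apply] at h ⊢
    exact_mod_cast h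
  linarith
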